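/- Let g be a Lie algebra over a field K of characteristic zero, and let p, q ⊆ g be Lie subalgebras such that g = p ⊕ q as K-modules; let π_p, π_q denote the corresponding linear projections onto p and q. Define a bilinear map B : g × g → g by B(X, Y) = π_p(⁅π_p X, π_q Y⁆) + π_p(⁅π_q X, π_p Y⁆) + ⁅π_q X, π_q Y⁆. Then B is alternating and satisfies the Jacobi identity B(B(X,Y),Z) + B(B(Y,Z),X) + B(B(Z,X),Y) = 0 for all X, Y, Z ∈ g; in other words, B defines a Lie algebra structure on the underlying vector space of g. -/

import Mathlib

/-- The modified bracket `B(X, Y) = π_p ⁅π_p X, π_q Y⁆ + π_p ⁅π_q X, π_p Y⁆ + ⁅π_q X, π_q Y⁆`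
associated to a pair of projections `π_p, π_q` coming from a direct sum decomposition
`g = p ⊕ q`. -/
def modBracket {g : Type*} [LieRing g] (πp πq : g → g) (X Y : g) : g :=
  πp ⁅πp X, πq Y⁆ + πp ⁅πq X, πp Y⁆ + ⁅πq X, πq Y⁆

/-- Let `g` be a Lie algebra over a field `K` of characteristic zero and
let `p, q ⊆ g` be Lie subalgebras with `g = p ⊕ q` as `K`-modules, with projections
`π_p, π_q`.  Then the modified bracket
`B(X, Y) = π_p ⁅π_p X, π_q Y⁆ + π_p ⁅π_q X, π_p Y⁆ + ⁅π_q X, π_q Y⁆`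
is alternating and satisfies the Jacobi identity, i.e. it defines a Lie algebra
structure on the underlying vector space of `g`. -/
theorem modBracket_alternating_and_jacobi {K g : Type*} [Field K] [CharZero K]
    [LieRing g] [LieAlgebra K g] (p q : LieSubalgebra K g)
    (hcompl : IsCompl p.toSubmodule q.toSubmodule)
    (πp πq : g →ₗ[K] g)
    (hπp : ∀ x : g, πp x ∈ p) (hπq : ∀ x : g, πq x ∈ q)
    (hsum : ∀ x : g, πp x + πq x = x) :
    (∀ X : g, modBracket (⇑πp) (⇑πq) X X = 0) ∧
      (∀ X Y Z : g,
        modBracket (⇑πp) (⇑πq) (modBracket (⇑πp) (⇑πq) X Y) Z +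
          modBracket (⇑πp) (⇑πq) (modBracket (⇑πp) (⇑πq) Y Z) X +
          modBracket (⇑πp) (⇑πq) (modBracket (⇑πp) (⇑πq) Z X) Y = 0) := by
  have hq0 : ∀ x ∈ q, πp x = 0 := by
    intro x hx
    have h1 : πp x ∈ q := by
      have h : πp x = x - πq x := eq_sub_of_add_eq (hsum x)
      rw [h]
      exact q.sub_mem hx (hπq x)
    exact (Submodule.disjoint_def.mp hcompl.disjoint) _ (hπp x) h1
  have hqq : ∀ x ∈ q, πq x = x := by
    intro x hx
    have h := hsum x
    rwa [hq0 x hx, zero_add] at h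
  have hpp : ∀ x, πp (πp x) = πp x := by
    intro x
    have h := congrArg πp (hsum x)
    rwa [map_add, hq0 _ (hπq x), add_zero] at h
  have hqp : ∀ x, πq (πp x) = 0 := by
    intro x
    have h := hsum (πp x)
    rwa [hpp, add_eq_left] at h
  have key : ∀ w, ∀ u ∈ q, πp ⁅πp w, u⁆ = πp ⁅w, u⁆ := by
    intro w u hu
    have h : ⁅w, u⁆ = ⁅πp w, u⁆ + ⁅πq w, u⁆ := by rw [← add_lie, hsum]
    rw [h, map_add, hq0 _ (q.lie_mem (hπq w) hu), add_zero]
  have jac : ∀ a b c : g, ⁅⁅a, b⁆, c⁆ + ⁅⁅b, c⁆, a⁆ + ⁅⁅c, a⁆, b⁆ = 0 := by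
    intro a b c
    have h := lie_jacobi a b c
    rw [← lie_skew ⁅a, b⁆ c, ← lie_skew ⁅b, c⁆ a, ← lie_skew ⁅c, a⁆ b,
      ← neg_eq_zero.mpr h]
    abel
  have hBB : ∀ X Y Z : g, modBracket (⇑πp) (⇑πq) (modBracket (⇑πp) (⇑πq) X Y) Z =
      πp (⁅⁅πp X, πq Y⁆, πq Z⁆ + ⁅⁅πq X, πp Y⁆, πq Z⁆ + ⁅⁅πq X, πq Y⁆, πp Z⁆)
        + ⁅⁅πq X, πq Y⁆, πq Z⁆ := by
    intro X Y Z
    have hm : ⁅πq X, πq Y⁆ ∈ q := q.lie_mem (hπq X) (hπq Y)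
    simp only [modBracket, map_add, hpp, hqp, hq0 _ hm, hqq _ hm, add_lie, zero_add, add_zero,
      key _ _ (hπq Z)]
  refine ⟨fun X => ?_, fun X Y Z => ?_⟩
  · simp only [modBracket, lie_self, add_zero]
    rw [← map_add, ← lie_skew (πp X) (πq X), neg_add_cancel, map_zero]
  · rw [hBB, hBB, hBB]
    have h0 := jac (πq X) (πq Y) (πq Z)
    have h1 := congrArg πp (jac (πp X) (πq Y) (πq Z))
    have h2 := congrArg πp (jac (πq X) (πp Y) (πq Z))
    have h3 := congrArg πp (jac (πq X) (πq Y) (πp Z))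
    simp only [map_add, map_zero] at h1 h2 h3 ⊢
    have h := congrArg₂ (· + ·) (congrArg₂ (· + ·) h0 h1) (congrArg₂ (· + ·) h2 h3)
    simp only [add_zero] at h
    rw [← h]
    abel
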